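/- Let μ be a nonzero positive admissible Borel measure on ℝⁿ and let g = log L(μ) on D_{L(μ)} (extended by +∞ elsewhere). Then the domain D_{g*} of the conjugate g*(α) = sup_{x ∈ ℝⁿ}(⟨α,x⟩ − g(x)) is a convex subset of ℝⁿ which is contained in C_μ and dense in C_μ. -/

import Mathlib

open scoped RealInnerProductSpace ENNReal
open MeasureTheory

/-- The Laplace transform `L(μ)(x) = ∫ e^{⟨α,x⟩} dμ(α) ∈ (0,+∞]` of a positive Borel
measure `μ` on `ℝⁿ`. -/
noncomputable def laplaceT {n : ℕ} (μ : Measure (EuclideanSpace ℝ (Fin n)))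
    (x : EuclideanSpace ℝ (Fin n)) : ℝ≥0∞ :=
  ∫⁻ α, ENNReal.ofReal (Real.exp ⟪α, x⟫) ∂μ

/-- The support of a measure: points all of whose open neighbourhoods have positive measure. -/
def measSupport {n : ℕ} (μ : Measure (EuclideanSpace ℝ (Fin n))) :
    Set (EuclideanSpace ℝ (Fin n)) :=
  {x | ∀ V : Set (EuclideanSpace ℝ (Fin n)), x ∈ V → IsOpen V → 0 < μ V}

/-- `g = log L(μ)` on `D_{L(μ)}`, extended by `+∞` elsewhere, as an `EReal`-valued function. -/
noncomputable def logLaplace {n : ℕ} (μ : Measure (EuclideanSpace ℝ (Fin n)))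
    (x : EuclideanSpace ℝ (Fin n)) : EReal :=
  if laplaceT μ x = ⊤ then ⊤ else ((Real.log (laplaceT μ x).toReal : ℝ) : EReal)

/-- The Fenchel conjugate `g*(α) = sup_x (⟨α,x⟩ − g(x))`. -/
noncomputable def fenchelConj {n : ℕ} (g : EuclideanSpace ℝ (Fin n) → EReal)
    (α : EuclideanSpace ℝ (Fin n)) : EReal :=
  ⨆ x : EuclideanSpace ℝ (Fin n), ((⟪α, x⟫ : ℝ) : EReal) - g x

theorem fenchelConj_logLaplace_ne_top_iff {n : ℕ} (μ : Measure (EuclideanSpace ℝ (Fin n)))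
    (α : EuclideanSpace ℝ (Fin n)) :
    fenchelConj (logLaplace μ) α ≠ ⊤ ↔
      ∃ M : ℝ, ∀ x, laplaceT μ x ≠ ⊤ → ⟪α, x⟫ - Real.log (laplaceT μ x).toReal ≤ M := by
  constructor
  · intro h
    obtain ⟨M, hM, -⟩ := EReal.lt_iff_exists_real_btwn.1 (lt_top_iff_ne_top.2 h)
    refine ⟨M, fun x hx => ?_⟩
    have h1 := (le_iSup (fun x : EuclideanSpace ℝ (Fin n) =>
      ((⟪α, x⟫ : ℝ) : EReal) - logLaplace μ x) x).trans hM.le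
    simp only [logLaplace, if_neg hx] at h1
    exact_mod_cast h1
  · rintro ⟨M, hM⟩
    refine ne_top_of_le_ne_top (EReal.coe_ne_top M) (iSup_le fun x => ?_)
    by_cases hx : laplaceT μ x = ⊤
    · simp [logLaplace, hx]
    · simp only [logLaplace, if_neg hx]
      exact_mod_cast hM x hx

theorem laplaceT_pos {n : ℕ} {μ : Measure (EuclideanSpace ℝ (Fin n))} (hμ : μ ≠ 0)
    (x : EuclideanSpace ℝ (Fin n)) : 0 < laplaceT μ x := by
  rw [laplaceT, lintegral_pos_iff_support (by fun_prop)]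
  have : Function.support (fun α : EuclideanSpace ℝ (Fin n) =>
      ENNReal.ofReal (Real.exp ⟪α, x⟫)) = Set.univ := by
    ext α
    simp [Real.exp_pos]
  rw [this]
  exact Measure.measure_univ_pos.2 hμ

theorem measSupport_eq_support {n : ℕ} (μ : Measure (EuclideanSpace ℝ (Fin n))) :
    measSupport μ = μ.support := by
  ext x
  rw [Measure.mem_support_iff_forall]
  constructor
  · intro h U hU
    obtain ⟨V, hVU, hV, hxV⟩ := mem_nhds_iff.1 hU
    exact (h V hxV hV).trans_le (measure_mono hVU)
  · exact fun h V hxV hV => h V (hV.mem_nhds hxV)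

theorem convex_domain_fenchelConj_logLaplace {n : ℕ} (μ : Measure (EuclideanSpace ℝ (Fin n))) :
    Convex ℝ {α | fenchelConj (logLaplace μ) α ≠ ⊤} := by
  intro α hα β hβ a b ha hb hab
  simp only [Set.mem_ofPred_eq, fenchelConj_logLaplace_ne_top_iff] at hα hβ ⊢
  obtain ⟨M, hM⟩ := hα
  obtain ⟨N, hN⟩ := hβ
  refine ⟨a * M + b * N, fun x hx => ?_⟩
  have h1 := mul_le_mul_of_nonneg_left (hM x hx) ha
  have h2 := mul_le_mul_of_nonneg_left (hN x hx) hb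
  rw [inner_add_left, real_inner_smul_left, real_inner_smul_left]
  linear_combination h1 + h2 + (Real.log (laplaceT μ x).toReal) * hab

theorem laplaceT_add_smul_le {n : ℕ} {μ : Measure (EuclideanSpace ℝ (Fin n))}
    {v : EuclideanSpace ℝ (Fin n)} {c t : ℝ} (ht : 0 ≤ t) (hc : ∀ᵐ α ∂μ, ⟪α, v⟫ ≤ c)
    (x : EuclideanSpace ℝ (Fin n)) :
    laplaceT μ (x + t • v) ≤ ENNReal.ofReal (Real.exp (t * c)) * laplaceT μ x := by
  rw [laplaceT, laplaceT, ← lintegral_const_mul _ (by fun_prop)]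
  refine lintegral_mono_ae ?_
  filter_upwards [hc] with α hα
  rw [← ENNReal.ofReal_mul (Real.exp_pos _).le, ← Real.exp_add, inner_add_right,
    real_inner_smul_right]
  refine ENNReal.ofReal_le_ofReal (Real.exp_le_exp.2 ?_)
  linarith [mul_le_mul_of_nonneg_left hα ht]

theorem domain_fenchelConj_logLaplace_subset {n : ℕ} {μ : Measure (EuclideanSpace ℝ (Fin n))}
    (hμ : μ ≠ 0) (hadm : {x | laplaceT μ x ≠ ⊤}.Nonempty) :
    {α | fenchelConj (logLaplace μ) α ≠ ⊤} ⊆ closure (convexHull ℝ (measSupport μ)) := by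
  intro α₀ hα₀
  by_contra hmem
  obtain ⟨M, hM⟩ := (fenchelConj_logLaplace_ne_top_iff μ α₀).1 hα₀
  obtain ⟨x₀, hx₀⟩ := hadm
  obtain ⟨f, c, hfc, hcf⟩ := geometric_hahn_banach_closed_point
    (convex_convexHull ℝ (measSupport μ)).closure isClosed_closure hmem
  set v := (InnerProductSpace.toDual ℝ (EuclideanSpace ℝ (Fin n))).symm f with hv
  have hfv : ∀ α, ⟪α, v⟫ = f α := fun α => by
    rw [real_inner_comm, hv, InnerProductSpace.toDual_symm_apply]
  have hc : ∀ᵐ α ∂μ, ⟪α, v⟫ ≤ c := by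
    have hsupp : ∀ᵐ α ∂μ, α ∈ measSupport μ := by
      rw [measSupport_eq_support]
      exact Measure.support_mem_ae
    filter_upwards [hsupp] with α hα
    rw [hfv]
    exact (hfc α (subset_closure (subset_convexHull ℝ _ hα))).le
  obtain ⟨k, hk⟩ := exists_nat_gt
    ((M - ⟪α₀, x₀⟫ + Real.log (laplaceT μ x₀).toReal) / (f α₀ - c))
  rw [div_lt_iff₀ (sub_pos.2 hcf)] at hk
  have hk0 : (0 : ℝ) ≤ k := k.cast_nonneg
  have hle := laplaceT_add_smul_le hk0 hc x₀
  have hfin : ENNReal.ofReal (Real.exp (k * c)) * laplaceT μ x₀ ≠ ⊤ :=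
    ENNReal.mul_ne_top ENNReal.ofReal_ne_top hx₀
  have hxk := ne_top_of_le_ne_top hfin hle
  have hlog : Real.log (laplaceT μ (x₀ + (k : ℝ) • v)).toReal ≤
      k * c + Real.log (laplaceT μ x₀).toReal := by
    have hpos := ENNReal.toReal_pos (laplaceT_pos hμ (x₀ + (k : ℝ) • v)).ne' hxk
    have hpos₀ := ENNReal.toReal_pos (laplaceT_pos hμ x₀).ne' hx₀
    have h := Real.log_le_log hpos (ENNReal.toReal_mono hfin hle)
    rwa [ENNReal.toReal_mul, ENNReal.toReal_ofReal (Real.exp_pos _).le,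
      Real.log_mul (Real.exp_pos _).ne' hpos₀.ne', Real.log_exp] at h
  have h := hM _ hxk
  rw [inner_add_right, real_inner_smul_right, hfv] at h
  linarith

theorem measure_lt_top_of_laplaceT_ne_top {n : ℕ} {μ : Measure (EuclideanSpace ℝ (Fin n))}
    {x : EuclideanSpace ℝ (Fin n)} (hx : laplaceT μ x ≠ ⊤) {K : Set (EuclideanSpace ℝ (Fin n))}
    (hK : IsCompact K) : μ K < ⊤ := by
  rcases K.eq_empty_or_nonempty with rfl | hne
  · simp
  obtain ⟨m, -, hm⟩ := hK.exists_isMinOn hne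
    (f := fun α : EuclideanSpace ℝ (Fin n) => Real.exp ⟪α, x⟫) (by fun_prop)
  have h : ENNReal.ofReal (Real.exp ⟪m, x⟫) * μ K ≤ laplaceT μ x := by
    rw [laplaceT, ← setLIntegral_const]
    refine (setLIntegral_mono (by fun_prop) fun α hα => ?_).trans (setLIntegral_le_lintegral K _)
    exact ENNReal.ofReal_le_ofReal (hm hα)
  refine lt_top_iff_ne_top.2 fun htop => hx (top_le_iff.1 ?_)
  rwa [htop, ENNReal.mul_top (by simp [Real.exp_pos])] at h

theorem setAverage_mem_domain_fenchelConj_logLaplace {n : ℕ}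
    {μ : Measure (EuclideanSpace ℝ (Fin n))} {K : Set (EuclideanSpace ℝ (Fin n))}
    (hK : IsCompact K) (h0 : μ K ≠ 0) (hfin : μ K ≠ ⊤) :
    fenchelConj (logLaplace μ) (⨍ α in K, α ∂μ) ≠ ⊤ := by
  rw [fenchelConj_logLaplace_ne_top_iff]
  refine ⟨-Real.log (μ.real K), fun x hx => ?_⟩
  have hμK : 0 < μ.real K := ENNReal.toReal_pos h0 hfin
  have hint : IntegrableOn (fun α : EuclideanSpace ℝ (Fin n) => Real.exp ⟪α, x⟫) K μ :=
    ContinuousOn.integrableOn_of_subset_isCompact (by fun_prop) hK hK.measurableSet subset_rfl hfin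
  have hconv : ConvexOn ℝ Set.univ (fun α : EuclideanSpace ℝ (Fin n) => Real.exp ⟪α, x⟫) := by
    refine (convexOn_exp.comp_linearMap (innerₗ (EuclideanSpace ℝ (Fin n)) x)).congr
      fun α _ => ?_
    simp [real_inner_comm]
  have hjensen := hconv.map_set_average_le (by fun_prop) isClosed_univ h0 hfin
    (Filter.Eventually.of_forall fun α => Set.mem_univ α)
    (f := fun α => α)
    (ContinuousOn.integrableOn_of_subset_isCompact (by fun_prop) hK hK.measurableSet subset_rfl
      hfin) hint
  rw [setAverage_eq _ (fun α => Real.exp ⟪α, x⟫), smul_eq_mul, inv_mul_eq_div,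
    le_div_iff₀ hμK] at hjensen
  have hle : ∫ α in K, Real.exp ⟪α, x⟫ ∂μ ≤ (laplaceT μ x).toReal := by
    rw [integral_eq_lintegral_of_nonneg_ae
      (Filter.Eventually.of_forall fun α => (Real.exp_pos _).le) hint.aestronglyMeasurable]
    exact ENNReal.toReal_mono hx (setLIntegral_le_lintegral K _)
  have hlog := Real.log_le_log (by positivity) (hjensen.trans hle)
  rw [Real.log_mul (Real.exp_pos _).ne' hμK.ne', Real.log_exp] at hlog
  linarith

theorem measSupport_subset_closure_domain {n : ℕ} {μ : Measure (EuclideanSpace ℝ (Fin n))}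
    (hadm : {x | laplaceT μ x ≠ ⊤}.Nonempty) :
    measSupport μ ⊆ closure {α | fenchelConj (logLaplace μ) α ≠ ⊤} := by
  intro s hs
  obtain ⟨x, hx⟩ := hadm
  refine Metric.mem_closure_iff.2 fun ε hε => ?_
  have hK : IsCompact (Metric.closedBall s (ε / 2)) := isCompact_closedBall _ _
  have hfin := (measure_lt_top_of_laplaceT_ne_top hx hK).ne
  have h0 : μ (Metric.closedBall s (ε / 2)) ≠ 0 :=
    ((hs _ (Metric.mem_ball_self (half_pos hε)) Metric.isOpen_ball).trans_le
      (measure_mono Metric.ball_subset_closedBall)).ne'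
  refine ⟨_, setAverage_mem_domain_fenchelConj_logLaplace hK h0 hfin, ?_⟩
  have hmem := (convex_closedBall s (ε / 2)).set_average_mem hK.isClosed h0 hfin
    (ae_restrict_mem hK.measurableSet) (f := fun α => α)
    (ContinuousOn.integrableOn_of_subset_isCompact (by fun_prop) hK hK.measurableSet subset_rfl
      hfin)
  rw [dist_comm]
  exact (Metric.mem_closedBall.1 hmem).trans_lt (half_lt_self hε)

/-- Let `μ` be a nonzero positive admissible Borel measure on `ℝⁿ` and
`g = log L(μ)`.  Then the domain `D_{g*}` of the conjugate `g*` is a convex subset of `ℝⁿ`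
contained in `C_μ` and dense in `C_μ`. -/
theorem domain_conj_logLaplace_dense_in_Cmu
    {n : ℕ} (μ : Measure (EuclideanSpace ℝ (Fin n)))
    (hμ : μ ≠ 0)
    (hadm : {x | laplaceT μ x ≠ ⊤}.Nonempty) :
    Convex ℝ {α | fenchelConj (logLaplace μ) α ≠ ⊤} ∧
    {α | fenchelConj (logLaplace μ) α ≠ ⊤} ⊆ closure (convexHull ℝ (measSupport μ)) ∧
    closure (convexHull ℝ (measSupport μ)) ⊆
      closure {α | fenchelConj (logLaplace μ) α ≠ ⊤} := by
  exact ⟨convex_domain_fenchelConj_logLaplace μ, domain_fenchelConj_logLaplace_subset hμ hadm,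
    closure_minimal (convexHull_min (measSupport_subset_closure_domain hadm)
      (convex_domain_fenchelConj_logLaplace μ).closure) isClosed_closure⟩
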